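/- Let κ₁,…,κ_m be d-linear forms on 𝔽_p^n and suppose κ_r has analytic rank at least R for some r ≤ m. Let B be an m×n matrix over 𝔽_p whose r-th row is not a linear combination of the other rows. Then at least one of the d-linear forms η_j = Σ_{i=1}^m b_{ij} κᵢ (j = 1,…,n) has analytic rank at least R/(2m)^d. -/

import Mathlib

open Finset

/-- The additive character `t ↦ exp(2πi t / p)` on `ZMod p`. -/
noncomputable def e (p : ℕ) (t : ZMod p) : ℂ :=
  Complex.exp (2 * Real.pi * Complex.I * (t.val : ℂ) / (p : ℂ))

/-- The absolute value of the normalised exponential sum of a multilinear form. -/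
noncomputable def multilinearBias {F V ι : Type*} [Field F] [AddCommGroup V] [Module F V]
    [Fintype V] [Fintype ι] [DecidableEq ι] (ψ : AddChar F ℂ)
    (f : MultilinearMap F (fun _ : ι => V) F) : ℝ :=
  ‖∑ x : ι → V, ψ (f x)‖ / Fintype.card (ι → V)

section Bias

variable {F V ι : Type*} [Field F] [AddCommGroup V] [Module F V]
  [Fintype V] [Fintype ι] [DecidableEq ι]

theorem sum_pi_eq_sum_sum_update (i : ι) (G : (ι → V) → ℂ) :
    ∑ x, G x = ∑ y : {j // j ≠ i} → V, ∑ v : V,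
      G (Function.update ((Equiv.funSplitAt i V).symm (0, y)) i v) := by
  rw [← (Equiv.funSplitAt i V).symm.sum_comp G, Fintype.sum_prod_type_right]
  refine Finset.sum_congr rfl fun y _ => Finset.sum_congr rfl fun v _ => congrArg G ?_
  ext j
  by_cases h : j = i
  · subst h
    simp
  · simp [h]

theorem AddChar.coe_norm_sum_eq_sum (χ : AddChar V ℂ) : ((‖∑ v, χ v‖ : ℝ) : ℂ) = ∑ v, χ v := by
  classical
  rw [AddChar.sum_eq_ite]
  split_ifs <;> simp

theorem multilinearBias_nonneg (ψ : AddChar F ℂ) (f : MultilinearMap F (fun _ : ι => V) F) :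
    0 ≤ multilinearBias ψ f := by
  unfold multilinearBias
  positivity

theorem multilinearBias_zero (ψ : AddChar F ℂ) :
    multilinearBias ψ (0 : MultilinearMap F (fun _ : ι => V) F) = 1 := by
  simp [multilinearBias]

variable [Finite F] (ψ : AddChar F ℂ)

theorem norm_sum_addChar_add_shift_le_update (f g : MultilinearMap F (fun _ : ι => V) F)
    (z : ι → V) (i : ι) :
    ‖∑ x, ψ (f x + g (x + z))‖ ≤ ‖∑ x, ψ (f x + g (x + Function.update z i 0))‖ := by
  let base (y : {j // j ≠ i} → V) : ι → V := (Equiv.funSplitAt i V).symm (0, y)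
  let χ (y : {j // j ≠ i} → V) : AddChar V ℂ :=
    ψ.compAddMonoidHom (f.toLinearMap (base y) i + g.toLinearMap (base y + z) i).toAddMonoidHom
  have hshift (y v) : ψ (f (Function.update (base y) i v) + g (Function.update (base y) i v + z))
      = χ y v * ψ (g (Function.update (base y + z) i (z i))) := by
    have h : Function.update (base y) i v + z = Function.update (base y + z) i (v + z i) := by
      ext j
      by_cases h : j = i
      · subst h; simp
      · simp [h]
    rw [h, g.map_update_add, ← add_assoc, ψ.map_add_eq_mul]
    rfl
  have hlinear (y v) : ψ (f (Function.update (base y) i v)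
      + g (Function.update (base y) i v + Function.update z i 0)) = χ y v := by
    have h : Function.update (base y) i v + Function.update z i 0
        = Function.update (base y + z) i v := by
      ext j
      by_cases h : j = i
      · subst h; simp
      · simp [h]
    rw [h]
    rfl
  have hright : ∑ x, ψ (f x + g (x + Function.update z i 0))
      = ((∑ y, ‖∑ v, χ y v‖ : ℝ) : ℂ) := by
    rw [sum_pi_eq_sum_sum_update i, Complex.ofReal_sum]
    refine Finset.sum_congr rfl fun y _ => ?_
    rw [AddChar.coe_norm_sum_eq_sum]
    exact Finset.sum_congr rfl fun v _ => hlinear y v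
  rw [hright, Complex.norm_of_nonneg (Finset.sum_nonneg fun _ _ => norm_nonneg _),
    sum_pi_eq_sum_sum_update i]
  refine (norm_sum_le _ _).trans (Finset.sum_le_sum fun y _ => le_of_eq ?_)
  rw [Finset.sum_congr rfl fun v _ => hshift y v, ← Finset.sum_mul, norm_mul,
    AddChar.norm_apply, mul_one]

theorem norm_sum_addChar_add_shift_le (f g : MultilinearMap F (fun _ : ι => V) F) (z : ι → V) :
    ‖∑ x, ψ (f x + g (x + z))‖ ≤ ‖∑ x, ψ ((f + g) x)‖ := by
  have h (s : Finset ι) :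
      ‖∑ x, ψ (f x + g (x + z))‖ ≤ ‖∑ x, ψ (f x + g (x + s.piecewise (0 : ι → V) z))‖ := by
    induction s using Finset.induction_on with
    | empty => simp
    | insert i s _ ih =>
      rw [Finset.piecewise_insert]
      exact ih.trans (norm_sum_addChar_add_shift_le_update ψ f g _ i)
  simpa using h Finset.univ

theorem multilinearBias_mul_le (f g : MultilinearMap F (fun _ : ι => V) F) :
    multilinearBias ψ f * multilinearBias ψ g ≤ multilinearBias ψ (f + g) := by
  have hcard : (0 : ℝ) < Fintype.card (ι → V) := by exact_mod_cast Fintype.card_pos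
  have hprod : (∑ x, ψ (f x)) * ∑ y, ψ (g y) = ∑ z, ∑ x, ψ (f x + g (x + z)) := by
    rw [Finset.sum_mul_sum, Finset.sum_comm (f := fun z x => ψ (f x + g (x + z)))]
    refine Finset.sum_congr rfl fun x _ => ?_
    rw [← Equiv.sum_comp (Equiv.addLeft x)]
    simp [ψ.map_add_eq_mul]
  have hle : ‖∑ x, ψ (f x)‖ * ‖∑ y, ψ (g y)‖
      ≤ Fintype.card (ι → V) * ‖∑ x, ψ ((f + g) x)‖ := by
    rw [← norm_mul, hprod]
    refine (norm_sum_le _ _).trans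
      ((Finset.sum_le_sum fun z _ => norm_sum_addChar_add_shift_le ψ f g z).trans_eq ?_)
    simp
  unfold multilinearBias
  rw [div_mul_div_comm, div_le_div_iff₀ (by positivity) hcard]
  nlinarith

theorem multilinearBias_le_one (f : MultilinearMap F (fun _ : ι => V) F) :
    multilinearBias ψ f ≤ 1 := by
  refine div_le_one_of_le₀ ((norm_sum_le _ _).trans ?_) (by positivity)
  simp

theorem multilinearBias_of_isEmpty [IsEmpty ι] (f : MultilinearMap F (fun _ : ι => V) F) :
    multilinearBias ψ f = 1 := by
  simp [multilinearBias]

theorem multilinearBias_le_smul (c : F) (f : MultilinearMap F (fun _ : ι => V) F) :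
    multilinearBias ψ f ≤ multilinearBias ψ (c • f) := by
  rcases isEmpty_or_nonempty ι with _ | ⟨⟨i⟩⟩
  · simp [multilinearBias_of_isEmpty]
  rcases eq_or_ne c 0 with rfl | hc
  · rw [zero_smul, multilinearBias_zero]
    exact multilinearBias_le_one ψ f
  refine le_of_eq ?_
  unfold multilinearBias
  let u : ι → Fˣ := Pi.mulSingle i (Units.mk0 c hc)
  have hu : ∏ j, (u j : F) = c := by
    rw [← Units.coe_prod, Finset.prod_pi_mulSingle']
    simp
  rw [← (Equiv.piCongrRight fun j => MulAction.toPerm (α := Fˣ) (β := V) (u j)).sum_comp]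
  have h (x : ι → V) : f ((Equiv.piCongrRight
      fun j => MulAction.toPerm (α := Fˣ) (β := V) (u j)) x) = (c • f) x := by
    rw [smul_apply, ← hu, ← f.map_smul_univ]
    rfl
  simp only [h]

theorem prod_multilinearBias_le_sum {α : Type*} (s : Finset α)
    (f : α → MultilinearMap F (fun _ : ι => V) F) :
    ∏ k ∈ s, multilinearBias ψ (f k) ≤ multilinearBias ψ (∑ k ∈ s, f k) := by
  classical
  induction s using Finset.induction_on with
  | empty => simp [multilinearBias_zero]
  | insert k s hk ih =>
    rw [Finset.prod_insert hk, Finset.sum_insert hk]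
    exact (mul_le_mul_of_nonneg_left ih (multilinearBias_nonneg ψ _)).trans
      (multilinearBias_mul_le ψ _ _)

end Bias

theorem Matrix.single_mem_span_range_transpose {F m n : Type*} [Field F] [Fintype n]
    [DecidableEq m] (B : Matrix m n F) (r : m)
    (hB : B r ∉ Submodule.span F {v : n → F | ∃ j, j ≠ r ∧ v = B j}) :
    Pi.single r 1 ∈ Submodule.span F (Set.range B.transpose) := by
  classical
  obtain ⟨φ, hφ, hker⟩ := Submodule.exists_le_ker_of_notMem hB
  have hcol : ∑ j, ((φ (B r))⁻¹ * φ (Pi.single j 1)) • B.transpose j = Pi.single r 1 := by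
    ext i
    have hi : (∑ j, ((φ (B r))⁻¹ * φ (Pi.single j 1)) • B.transpose j) i
        = (φ (B r))⁻¹ * φ (B i) := by
      rw [φ.pi_apply_eq_sum_univ (B i), Finset.mul_sum, Finset.sum_apply]
      refine Finset.sum_congr rfl fun j _ => ?_
      have : (fun k => if j = k then (1 : F) else 0) = Pi.single j 1 := by
        ext k
        simp [Pi.single_apply, eq_comm]
      simp only [this, Pi.smul_apply, Matrix.transpose_apply, smul_eq_mul]
      ring
    rw [hi]
    by_cases h : i = r
    · subst h
      simp [hφ]
    · have : φ (B i) = 0 := hker (Submodule.subset_span ⟨i, h, rfl⟩)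
      simp [this, h]
  rw [← hcol]
  exact Submodule.sum_mem _ fun j _ =>
    Submodule.smul_mem _ _ (Submodule.subset_span ⟨j, rfl⟩)

theorem exists_fintype_sum_smul_eq_of_mem_span {F E : Type*} {α : Type} [Field F]
    [AddCommGroup E] [Module F E] [FiniteDimensional F E] (v : α → E) {w : E}
    (hw : w ∈ Submodule.span F (Set.range v)) :
    ∃ (β : Type) (_ : Fintype β) (a : β → α) (c : β → F),
      Fintype.card β ≤ Module.finrank F E ∧ ∑ k, c k • v (a k) = w := by
  obtain ⟨β, a, -, hspan, hli⟩ := exists_linearIndependent' F v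
  have := hli.finite
  have := Fintype.ofFinite β
  rw [← hspan, Submodule.mem_span_range_iff_exists_fun] at hw
  obtain ⟨c, hc⟩ := hw
  exact ⟨β, this, a, c, hli.fintype_card_le_finrank, hc⟩

theorem e_eq_stdAddChar (p : ℕ) [NeZero p] (t : ZMod p) : e p t = ZMod.stdAddChar t := by
  rw [ZMod.stdAddChar_apply, ZMod.toCircle_apply, e]

theorem multilinearBias_eq_rpow {p n d : ℕ} [Fact p.Prime]
    (f : MultilinearMap (ZMod p) (fun _ : Fin d => (Fin n → ZMod p)) (ZMod p)) {r : ℝ}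
    (hf : (∑ x : Fin d → (Fin n → ZMod p), e p (f x))
        / (Fintype.card (Fin d → (Fin n → ZMod p)) : ℂ) = (((p : ℝ) ^ (-r) : ℝ) : ℂ)) :
    multilinearBias ZMod.stdAddChar f = (p : ℝ) ^ (-r) := by
  have h := congrArg norm hf
  rw [norm_div, Complex.norm_natCast, Complex.norm_of_nonneg (by positivity)] at h
  simpa only [multilinearBias, e_eq_stdAddChar] using h

/-- let `κ₁,…,κ_m` be `d`-linear forms on `𝔽_p^n` (of analytic
ranks `rk i`), with `rk r₀ ≥ R` for some `r₀`, and let `B` be an `m×N` matrix over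
`𝔽_p` whose `r₀`-th row is not a linear combination of the other rows. Then at
least one of the `d`-linear forms `η_j = Σᵢ b_{ij} κᵢ` (of analytic rank `ρ j`)
has rank at least `R/(2m)^d`. -/
theorem stmt17 (p n d m N : ℕ) [Fact p.Prime]
    (κ : Fin m → MultilinearMap (ZMod p) (fun _ : Fin d => (Fin n → ZMod p)) (ZMod p))
    (rk : Fin m → ℝ)
    (hκ : ∀ i, (∑ x : Fin d → (Fin n → ZMod p), e p (κ i x))
        / (Fintype.card (Fin d → (Fin n → ZMod p)) : ℂ)
      = (((p : ℝ) ^ (-(rk i)) : ℝ) : ℂ))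
    (r₀ : Fin m) (R : ℝ) (hR : R ≤ rk r₀)
    (B : Matrix (Fin m) (Fin N) (ZMod p))
    (hB : B r₀ ∉ Submodule.span (ZMod p) {v : Fin N → ZMod p | ∃ j, j ≠ r₀ ∧ v = B j})
    (ρ : Fin N → ℝ)
    (hρ : ∀ j, (∑ x : Fin d → (Fin n → ZMod p), e p ((∑ i, B i j • κ i) x))
        / (Fintype.card (Fin d → (Fin n → ZMod p)) : ℂ)
      = (((p : ℝ) ^ (-(ρ j)) : ℝ) : ℂ)) :
    ∃ j, R / (2 * m) ^ d ≤ ρ j := by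
  have hp : (1 : ℝ) < p := by exact_mod_cast (Fact.out : p.Prime).one_lt
  have hbias_κ := multilinearBias_eq_rpow (κ r₀) (hκ r₀)
  have hbias_η j := multilinearBias_eq_rpow _ (hρ j)
  obtain ⟨β, _, a, c, hcard, hc⟩ := exists_fintype_sum_smul_eq_of_mem_span _
    (B.single_mem_span_range_transpose r₀ hB)
  rw [Module.finrank_fin_fun] at hcard
  have hβ : Nonempty β := by
    by_contra h
    rw [not_nonempty_iff] at h
    simpa using congrFun hc r₀
  have hκ_eq : κ r₀ = ∑ k, c k • ∑ i, B i (a k) • κ i := by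
    simp only [Finset.smul_sum, smul_smul]
    rw [Finset.sum_comm]
    simp only [← Finset.sum_smul]
    have hcoeff (i : Fin m) :
        ∑ k, c k * B i (a k) = (Pi.single r₀ 1 : Fin m → ZMod p) i := by
      rw [← hc, Finset.sum_apply]
      rfl
    simp [hcoeff, Pi.single_apply]
  have hrank : rk r₀ ≤ ∑ k, ρ (a k) := by
    have h : (p : ℝ) ^ (-∑ k, ρ (a k)) ≤ (p : ℝ) ^ (-rk r₀) := by
      rw [← Finset.sum_neg_distrib, Real.rpow_sum_of_pos (by linarith), ← hbias_κ, hκ_eq]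
      refine (Finset.prod_le_prod (fun _ _ => by positivity) fun k _ => ?_).trans
        (prod_multilinearBias_le_sum _ _ _)
      rw [← hbias_η]
      exact multilinearBias_le_smul _ _ _
    linarith [(Real.rpow_le_rpow_left_iff hp).1 h]
  have hρ_nonneg j : 0 ≤ ρ j := by
    have h := (hbias_η j).symm.trans_le (multilinearBias_le_one _ _)
    rw [← Real.rpow_zero (p : ℝ), Real.rpow_le_rpow_left_iff hp] at h
    linarith
  by_contra! hlt
  obtain ⟨k₀⟩ := hβ
  have hm : (1 : ℝ) ≤ m := by exact_mod_cast r₀.pos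
  have hR_pos : 0 < R / (2 * m) ^ d := (hρ_nonneg (a k₀)).trans_lt (hlt _)
  have hsum : ∑ k, ρ (a k) < m * (R / (2 * m) ^ d) := by
    refine (Finset.sum_lt_sum_of_nonempty ⟨k₀, Finset.mem_univ _⟩ fun k _ => hlt (a k)).trans_le ?_
    rw [Finset.sum_const, nsmul_eq_mul, Finset.card_univ]
    gcongr
  rcases Nat.eq_zero_or_pos d with rfl | hd
  · have h := hbias_κ
    rw [multilinearBias_of_isEmpty, ← Real.rpow_zero (p : ℝ)] at h
    have h := (Real.rpow_le_rpow_left_iff hp).1 h.le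
    simp only [pow_zero, div_one] at hR_pos
    linarith
  · have hpow : (m : ℝ) ≤ (2 * m) ^ d :=
      (by linarith : (m : ℝ) ≤ 2 * m).trans (le_self_pow₀ (by linarith) hd.ne')
    have hle : m * (R / (2 * m) ^ d) ≤ (2 * m) ^ d * (R / (2 * m) ^ d) := by gcongr
    rw [mul_div_cancel₀ R (by positivity)] at hle
    linarith
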